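/- (Theorem 2.4, first mapping of (2.4).) Let α > 0 and assume either m ≥ 0, or m < 0 and θ < α. Then the logarithmic-derivative function q ↦ q·I'_{α,ψ}(q)/I_{α,ψ}(q) is a Bernstein function vanishing at 0: there exist a ≥ 0 and a Borel measure μ on (0,∞) with ∫₀^∞ min(1,r) μ(dr) < ∞ such that q·I'_{α,ψ}(q)/I_{α,ψ}(q) = a·q + ∫₀^∞ (1 − e^{−q·r}) μ(dr) for all q ≥ 0. Equivalently, q ↦ exp( −q·I'_{α,ψ}(q)/I_{α,ψ}(q) ) is the Laplace transform of an infinitely divisible probability distribution on [0,∞). -/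

import Mathlib

open MeasureTheory Real Set Filter Topology

/-- The Laplace exponent of a spectrally negative infinitely divisible random variable. -/
noncomputable def psi (σ b : ℝ) (ν : Measure ℝ) (u : ℝ) : ℝ :=
  b * u + σ / 2 * u ^ 2 +
    ∫ r in Ioi (0 : ℝ), (Real.exp (-u * r) - 1 + (if r ≤ 1 then u * r else 0)) ∂ν

/-- The coefficients `a_n(ψ;α) = (∏_{k=1}^n ψ(αk))⁻¹`, with `a_0 = 1`. -/
noncomputable def coeffA (ψ : ℝ → ℝ) (α : ℝ) (n : ℕ) : ℝ :=
  (∏ k ∈ Finset.range n, ψ (α * (k + 1)))⁻¹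

/-- The power series `I_{α,ψ}(x) = Σ_{n≥0} a_n(ψ;α) x^n`. -/
noncomputable def Iser (ψ : ℝ → ℝ) (α : ℝ) (x : ℝ) : ℝ :=
  ∑' n : ℕ, coeffA ψ α n * x ^ n

/-- The functions `q ↦ exp (-r q⁺)` with `r ≥ 0`. -/
def laplaceKernels : Set (ℝ → ℝ) :=
  (fun r q => Real.exp (-(r * max q 0))) '' Ici (0 : ℝ)

/-- Pointwise limits of Laplace transforms of finitely supported probability measures on `[0,∞)`,
extended to the negative half-line by their value at `0`. -/
def laplaceSet : Set (ℝ → ℝ) :=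
  closure (convexHull ℝ laplaceKernels)

/-- The functions `f` for which every `exp (-s f)`, `s ≥ 0`, is a pointwise limit of Laplace
transforms. -/
def bernsteinSet : Set (ℝ → ℝ) :=
  {f | ∀ s : ℝ, 0 ≤ s → (fun q => Real.exp (-(s * f q))) ∈ laplaceSet}

lemma isClosed_laplaceSet : IsClosed laplaceSet := isClosed_closure

lemma convex_laplaceSet : Convex ℝ laplaceSet := (convex_convexHull ℝ _).closure

lemma laplaceKernels_subset : laplaceKernels ⊆ laplaceSet :=
  (subset_convexHull ℝ _).trans subset_closure

/-- A closed convex set containing the kernels contains the whole of `laplaceSet`. -/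
lemma laplaceSet_subset {T : Set (ℝ → ℝ)} (hc : IsClosed T) (hT : Convex ℝ T)
    (hk : ∀ r : ℝ, 0 ≤ r → (fun q => Real.exp (-(r * max q 0))) ∈ T) : laplaceSet ⊆ T :=
  closure_minimal (convexHull_min (by rintro _ ⟨r, hr, rfl⟩; exact hk r hr) hT) hc

lemma one_mem_laplaceSet : (1 : ℝ → ℝ) ∈ laplaceSet :=
  laplaceKernels_subset ⟨0, by simp, by ext; simp⟩

lemma mul_mem_laplaceSet {f g : ℝ → ℝ} (hf : f ∈ laplaceSet) (hg : g ∈ laplaceSet) :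
    f * g ∈ laplaceSet := by
  have key : ∀ u : ℝ → ℝ, (∀ r : ℝ, 0 ≤ r →
      (fun q => Real.exp (-(r * max q 0))) * u ∈ laplaceSet) →
      ∀ v ∈ laplaceSet, v * u ∈ laplaceSet := by
    intro u hu
    refine laplaceSet_subset (T := {v | v * u ∈ laplaceSet}) ?_ ?_ hu
    · exact isClosed_laplaceSet.preimage (continuous_id.mul continuous_const)
    · intro v hv w hw a b ha hb hab
      have := convex_laplaceSet hv hw ha hb hab
      simpa [add_mul, smul_mul_assoc] using this
  refine key g (fun r hr => ?_) f hf
  rw [mul_comm]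
  refine key _ (fun s hs => ?_) g hg
  refine laplaceKernels_subset ⟨s + r, by simp only [mem_Ici]; linarith, ?_⟩
  ext q
  simp only [Pi.mul_apply, ← Real.exp_add]
  ring_nf

lemma pow_mem_laplaceSet {f : ℝ → ℝ} (hf : f ∈ laplaceSet) (n : ℕ) : f ^ n ∈ laplaceSet := by
  induction n with
  | zero => simpa using one_mem_laplaceSet
  | succ n ih => rw [pow_succ]; exact mul_mem_laplaceSet ih hf

lemma comp_mul_mem_laplaceSet {f : ℝ → ℝ} (hf : f ∈ laplaceSet) {v : ℝ} (hv : 0 ≤ v) :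
    (fun q => f (v * q)) ∈ laplaceSet := by
  refine laplaceSet_subset (T := {f | (fun q => f (v * q)) ∈ laplaceSet}) ?_ ?_ ?_ hf
  · exact isClosed_laplaceSet.preimage (continuous_pi fun q => continuous_apply _)
  · intro g hg w hw a b ha hb hab
    exact convex_laplaceSet hg hw ha hb hab
  · intro r hr
    refine laplaceKernels_subset ⟨r * v, mul_nonneg hr hv, ?_⟩
    ext q
    simp only
    rw [mul_assoc, mul_max_of_nonneg _ _ hv, mul_zero]

lemma laplaceSet_le_one {f : ℝ → ℝ} (hf : f ∈ laplaceSet) (q : ℝ) : f q ≤ 1 := by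
  refine laplaceSet_subset (T := {f | f q ≤ 1}) ?_ ?_ ?_ hf
  · exact isClosed_le (continuous_apply q) continuous_const
  · intro g hg w hw a b ha hb hab
    simp only [mem_ofPred_eq, Pi.add_apply, Pi.smul_apply, smul_eq_mul] at *
    nlinarith
  · intro r hr
    simp only [mem_ofPred_eq, Real.exp_le_one_iff]
    have := mul_nonneg hr (le_max_right q 0)
    linarith

lemma antitone_of_mem_laplaceSet {f : ℝ → ℝ} (hf : f ∈ laplaceSet) : Antitone f := by
  intro x y hxy
  refine laplaceSet_subset (T := {f | f y ≤ f x}) ?_ ?_ ?_ hf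
  · exact isClosed_le (continuous_apply y) (continuous_apply x)
  · intro g hg w hw a b ha hb hab
    simp only [mem_ofPred_eq, Pi.add_apply, Pi.smul_apply, smul_eq_mul] at *
    gcongr
  · intro r hr
    simp only [mem_ofPred_eq]
    gcongr

lemma isClosed_bernsteinSet : IsClosed bernsteinSet := by
  simp only [bernsteinSet, ofPred_forall]
  refine isClosed_iInter fun s => isClosed_iInter fun _ => ?_
  exact isClosed_laplaceSet.preimage (by fun_prop)

lemma zero_mem_bernsteinSet : (0 : ℝ → ℝ) ∈ bernsteinSet := by
  intro s _
  convert one_mem_laplaceSet using 1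
  ext; simp

lemma add_mem_bernsteinSet {f g : ℝ → ℝ} (hf : f ∈ bernsteinSet) (hg : g ∈ bernsteinSet) :
    f + g ∈ bernsteinSet := by
  intro s hs
  convert mul_mem_laplaceSet (hf s hs) (hg s hs) using 1
  ext q
  simp only [Pi.add_apply, Pi.mul_apply, ← Real.exp_add]
  ring_nf

lemma smul_mem_bernsteinSet {f : ℝ → ℝ} (hf : f ∈ bernsteinSet) {c : ℝ} (hc : 0 ≤ c) :
    c • f ∈ bernsteinSet := by
  intro s hs
  convert hf (s * c) (mul_nonneg hs hc) using 1
  ext q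
  simp [mul_assoc]

lemma convex_bernsteinSet : Convex ℝ bernsteinSet := fun _ hf _ hg _ _ ha hb _ =>
  add_mem_bernsteinSet (smul_mem_bernsteinSet hf ha) (smul_mem_bernsteinSet hg hb)

lemma comp_mul_mem_bernsteinSet {f : ℝ → ℝ} (hf : f ∈ bernsteinSet) {v : ℝ} (hv : 0 ≤ v) :
    (fun q => f (v * q)) ∈ bernsteinSet :=
  fun s hs => comp_mul_mem_laplaceSet (hf s hs) hv

lemma posPart_mem_bernsteinSet : (fun q : ℝ => max q 0) ∈ bernsteinSet :=
  fun s hs => laplaceKernels_subset ⟨s, hs, rfl⟩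

lemma one_sub_mem_bernsteinSet {g : ℝ → ℝ} (hg : g ∈ laplaceSet) :
    (fun q => 1 - g q) ∈ bernsteinSet := by
  intro s hs
  have hlim : Tendsto (fun n : ℕ => fun q : ℝ => (1 + (-(s * (1 - g q))) / n) ^ n) atTop
      (𝓝 (fun q => Real.exp (-(s * (1 - g q))))) :=
    tendsto_pi_nhds.2 fun q => Real.tendsto_one_add_div_pow_exp _
  refine isClosed_laplaceSet.mem_of_tendsto hlim ?_
  obtain ⟨N, hN⟩ := exists_nat_ge (s + 1)
  filter_upwards [eventually_ge_atTop N] with n hn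
  have hn' : s + 1 ≤ n := hN.trans (by exact_mod_cast hn)
  have hn0 : (0 : ℝ) < n := by linarith
  have h := convex_laplaceSet one_mem_laplaceSet hg (a := 1 - s / n) (b := s / n)
    (by rw [sub_nonneg, div_le_one hn0]; linarith) (by positivity) (by ring)
  convert pow_mem_laplaceSet h n using 1
  ext q
  simp only [Pi.pow_apply, Pi.add_apply, Pi.smul_apply, Pi.one_apply, smul_eq_mul]
  congr 1
  ring

lemma one_sub_exp_neg_mem_bernsteinSet {f : ℝ → ℝ} (hf : f ∈ bernsteinSet) :
    (fun q => 1 - Real.exp (-f q)) ∈ bernsteinSet := by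
  refine one_sub_mem_bernsteinSet ?_
  simpa using hf 1 zero_le_one

lemma nonneg_of_mem_bernsteinSet {f : ℝ → ℝ} (hf : f ∈ bernsteinSet) (q : ℝ) : 0 ≤ f q := by
  have := laplaceSet_le_one (hf 1 zero_le_one) q
  simpa using this

lemma monotone_of_mem_bernsteinSet {f : ℝ → ℝ} (hf : f ∈ bernsteinSet) : Monotone f := by
  intro x y hxy
  have := antitone_of_mem_laplaceSet (hf 1 zero_le_one) hxy
  simpa using this

lemma integral_mem_bernsteinSet {Y : Type*} [MeasurableSpace Y] (μ : Measure Y) [IsFiniteMeasure μ]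
    {F : Y → ℝ → ℝ} (hF : ∀ᵐ y ∂μ, F y ∈ bernsteinSet)
    (hint : ∀ q, Integrable (fun y => F y q) μ) :
    (fun q => ∫ y, F y q ∂μ) ∈ bernsteinSet := by
  rcases eq_zero_or_neZero μ with rfl | hμ
  · simpa using! zero_mem_bernsteinSet
  rw [← isClosed_bernsteinSet.closure_eq, _root_.mem_closure_iff]
  intro U hU hfU
  obtain ⟨I, u, hu, hIU⟩ := isOpen_pi_iff.1 hU _ hfU
  let R : (ℝ → ℝ) →ₗ[ℝ] (I → ℝ) := LinearMap.funLeft ℝ ℝ (fun i : I => (i : ℝ))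
  have hRi : ∀ f i, R f i = f i := fun f i => rfl
  have hint' : Integrable (fun y => R (μ.real univ • F y)) μ := by
    refine Integrable.of_eval fun i => ?_
    simpa [hRi] using (hint i).const_mul _
  have hmem := (convex_bernsteinSet.linear_image R).closure.average_mem isClosed_closure
    (f := fun y => R (μ.real univ • F y)) (μ := μ)
    (hF.mono fun y hy => subset_closure
      ⟨_, smul_mem_bernsteinSet hy measureReal_nonneg, rfl⟩) hint'
  have hav : ⨍ y, R (μ.real univ • F y) ∂μ = R (fun q => ∫ y, F y q ∂μ) := by
    have : μ.real univ ≠ 0 := by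
      simp [measureReal_def, ENNReal.toReal_eq_zero_iff, NeZero.ne μ]
    ext i
    rw [average_eq, Pi.smul_apply, eval_integral (fun i => hint'.eval i)]
    simp only [Pi.smul_apply, hRi, smul_eq_mul, integral_const_mul]
    field_simp
  rw [hav, _root_.mem_closure_iff] at hmem
  obtain ⟨_, hx, f, hf, rfl⟩ := hmem (univ.pi fun i : I => u i)
    (isOpen_set_pi finite_univ fun i _ => (hu i i.2).1) (fun i _ => (hu i i.2).2)
  exact ⟨f, hIU fun i hi => hx ⟨i, hi⟩ trivial, hf⟩

section PowerSeries

open scoped Nat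

lemma summable_factorial_bound (M K R : ℝ) : Summable fun n : ℕ => M * K ^ n / n ! * R ^ n := by
  refine ((Real.summable_pow_div_factorial (K * R)).mul_left M).congr fun n => ?_
  rw [mul_pow]; ring

lemma summable_of_factorial_bound {a : ℕ → ℝ} {M K : ℝ} (ha : ∀ n, |a n| ≤ M * K ^ n / n !)
    (x : ℝ) : Summable fun n => a n * x ^ n := by
  refine Summable.of_norm_bounded (summable_factorial_bound M K |x|) fun n => ?_
  rw [Real.norm_eq_abs, abs_mul, abs_pow]
  gcongr
  exact ha n

lemma factorial_bound_succ {a : ℕ → ℝ} {M K : ℝ} (ha : ∀ n, |a n| ≤ M * K ^ n / n !) (n : ℕ) :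
    |((n : ℝ) + 1) * a (n + 1)| ≤ M * K * K ^ n / n ! := by
  have h := ha (n + 1)
  rw [abs_mul, abs_of_nonneg (by positivity : (0 : ℝ) ≤ n + 1)]
  rw [Nat.factorial_succ] at h
  push_cast at h
  calc ((n : ℝ) + 1) * |a (n + 1)| ≤ (n + 1) * (M * K ^ (n + 1) / ((n + 1) * n !)) := by gcongr
    _ = M * K * K ^ n / n ! := by field_simp; ring

lemma hasDerivAt_tsum_of_factorial_bound {a : ℕ → ℝ} {M K : ℝ} (hK : 0 ≤ K)
    (ha : ∀ n, |a n| ≤ M * K ^ n / n !) (x : ℝ) :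
    HasDerivAt (fun x => ∑' n, a n * x ^ n) (∑' n : ℕ, ((n : ℝ) + 1) * a (n + 1) * x ^ n) x := by
  set R := |x| + 1
  have hM : 0 ≤ M := by simpa using (abs_nonneg _).trans (ha 0)
  have hu : Summable fun n : ℕ => (n : ℝ) * (M * K ^ n / n !) * R ^ (n - 1) := by
    rw [← summable_nat_add_iff 1]
    refine (summable_factorial_bound (M * K) K R).congr fun n => ?_
    rw [Nat.factorial_succ, Nat.add_sub_cancel]
    push_cast
    field_simp
    ring
  have h := hasDerivAt_tsum_of_isPreconnected (g := fun n x => a n * x ^ n)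
    (g' := fun n x => a n * (n * x ^ (n - 1))) (t := Metric.ball 0 R) (y₀ := 0) (y := x) hu
    Metric.isOpen_ball (convex_ball 0 R).isPreconnected
    (fun n y _ => (hasDerivAt_pow n y).const_mul (a n))
    (fun n y hy => by
      have hy' : |y| ≤ R := by
        have := Metric.mem_ball.1 hy
        rw [Real.dist_eq, sub_zero] at this
        exact this.le
      rw [Real.norm_eq_abs, abs_mul, abs_mul, abs_pow, Nat.abs_cast]
      calc |a n| * (n * |y| ^ (n - 1)) ≤ (M * K ^ n / n !) * (n * R ^ (n - 1)) := by
            gcongr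
            exact ha n
        _ = _ := by ring)
    (Metric.mem_ball_self (by positivity)) (summable_of_factorial_bound ha 0)
    (by simp [R])
  refine h.congr_deriv ?_
  have hs : Summable fun n : ℕ => a n * (n * x ^ (n - 1)) := by
    rw [← summable_nat_add_iff 1]
    refine (summable_of_factorial_bound (factorial_bound_succ ha) x).congr fun n => ?_
    push_cast
    ring
  rw [hs.tsum_eq_zero_add]
  simp only [Nat.cast_zero, zero_mul, mul_zero, zero_add, Nat.add_sub_cancel]
  refine Eq.symm ?_
  refine tsum_congr fun n => ?_
  push_cast
  ring

end PowerSeries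

section Coefficients

open scoped Nat

variable {ψ : ℝ → ℝ} {α c : ℝ}

lemma coeffA_succ (ψ : ℝ → ℝ) (α : ℝ) (n : ℕ) :
    coeffA ψ α (n + 1) = coeffA ψ α n * (ψ (α * (n + 1)))⁻¹ := by
  rw [coeffA, coeffA, Finset.prod_range_succ, mul_inv]

lemma coeffA_zero (ψ : ℝ → ℝ) (α : ℝ) : coeffA ψ α 0 = 1 := by simp [coeffA]

lemma coeffA_pos (hc : 0 < c) (h : ∀ k : ℕ, c * (k + 1) ≤ ψ (α * (k + 1))) (n : ℕ) :
    0 < coeffA ψ α n :=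
  inv_pos.2 (Finset.prod_pos fun k _ => lt_of_lt_of_le (by positivity) (h k))

lemma succ_mul_coeffA_succ_le (hc : 0 < c) (h : ∀ k : ℕ, c * (k + 1) ≤ ψ (α * (k + 1))) (n : ℕ) :
    ((n : ℝ) + 1) * coeffA ψ α (n + 1) ≤ c⁻¹ * coeffA ψ α n := by
  have h0 := coeffA_pos hc h n
  rw [coeffA_succ]
  calc ((n : ℝ) + 1) * (coeffA ψ α n * (ψ (α * (n + 1)))⁻¹)
      ≤ (n + 1) * (coeffA ψ α n * (c * (n + 1))⁻¹) := by
        gcongr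
        exact h n
    _ = c⁻¹ * coeffA ψ α n := by field_simp

lemma abs_coeffA_le (hc : 0 < c) (h : ∀ k : ℕ, c * (k + 1) ≤ ψ (α * (k + 1))) (n : ℕ) :
    |coeffA ψ α n| ≤ 1 * c⁻¹ ^ n / n ! := by
  rw [abs_of_pos (coeffA_pos hc h n)]
  induction n with
  | zero => simp [coeffA_zero]
  | succ n ih =>
    have h1 := succ_mul_coeffA_succ_le hc h n
    have h2 : ((n : ℝ) + 1) * coeffA ψ α (n + 1) ≤ c⁻¹ * (1 * c⁻¹ ^ n / n !) :=
      h1.trans (by gcongr)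
    rw [← le_div_iff₀' (by positivity)] at h2
    refine h2.trans_eq ?_
    rw [Nat.factorial_succ, pow_succ]
    push_cast
    field_simp

/-- The termwise derivative of `Iser ψ α`. -/
noncomputable def IserDeriv (ψ : ℝ → ℝ) (α : ℝ) (x : ℝ) : ℝ :=
  ∑' n : ℕ, ((n : ℝ) + 1) * coeffA ψ α (n + 1) * x ^ n

lemma summable_Iser (hc : 0 < c) (h : ∀ k : ℕ, c * (k + 1) ≤ ψ (α * (k + 1))) (x : ℝ) :
    Summable fun n => coeffA ψ α n * x ^ n :=
  summable_of_factorial_bound (abs_coeffA_le hc h) x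

lemma summable_IserDeriv (hc : 0 < c) (h : ∀ k : ℕ, c * (k + 1) ≤ ψ (α * (k + 1))) (x : ℝ) :
    Summable fun n : ℕ => ((n : ℝ) + 1) * coeffA ψ α (n + 1) * x ^ n :=
  summable_of_factorial_bound (factorial_bound_succ (abs_coeffA_le hc h)) x

lemma hasDerivAt_Iser (hc : 0 < c) (h : ∀ k : ℕ, c * (k + 1) ≤ ψ (α * (k + 1))) (x : ℝ) :
    HasDerivAt (Iser ψ α) (IserDeriv ψ α x) x :=
  hasDerivAt_tsum_of_factorial_bound (by positivity) (abs_coeffA_le hc h) x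

lemma continuous_Iser (hc : 0 < c) (h : ∀ k : ℕ, c * (k + 1) ≤ ψ (α * (k + 1))) :
    Continuous (Iser ψ α) :=
  continuous_iff_continuousAt.2 fun x => (hasDerivAt_Iser hc h x).continuousAt

lemma continuous_IserDeriv (hc : 0 < c) (h : ∀ k : ℕ, c * (k + 1) ≤ ψ (α * (k + 1))) :
    Continuous (IserDeriv ψ α) :=
  continuous_iff_continuousAt.2 fun x => (hasDerivAt_tsum_of_factorial_bound (by positivity)
    (factorial_bound_succ (abs_coeffA_le hc h)) x).continuousAt

lemma one_le_Iser (hc : 0 < c) (h : ∀ k : ℕ, c * (k + 1) ≤ ψ (α * (k + 1))) {x : ℝ} (hx : 0 ≤ x) :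
    1 ≤ Iser ψ α x := by
  have := (summable_Iser hc h x).le_tsum 0 fun n _ =>
    mul_nonneg (coeffA_pos hc h n).le (pow_nonneg hx n)
  simpa [coeffA_zero, Iser] using this

lemma IserDeriv_nonneg (hc : 0 < c) (h : ∀ k : ℕ, c * (k + 1) ≤ ψ (α * (k + 1))) {x : ℝ}
    (hx : 0 ≤ x) : 0 ≤ IserDeriv ψ α x :=
  tsum_nonneg fun n => by
    have := (coeffA_pos hc h (n + 1)).le
    positivity

lemma IserDeriv_le (hc : 0 < c) (h : ∀ k : ℕ, c * (k + 1) ≤ ψ (α * (k + 1))) {x : ℝ}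
    (hx : 0 ≤ x) : IserDeriv ψ α x ≤ c⁻¹ * Iser ψ α x := by
  rw [Iser, ← tsum_mul_left]
  refine (summable_IserDeriv hc h x).tsum_le_tsum (fun n => ?_) ((summable_Iser hc h x).mul_left _)
  rw [← mul_assoc]
  exact mul_le_mul_of_nonneg_right (succ_mul_coeffA_succ_le hc h n) (pow_nonneg hx n)

end Coefficients

section FunctionalEquation

variable {Y : Type*} [MeasurableSpace Y] {lam : Measure Y} [IsFiniteMeasure lam] {s : Y → ℝ}
  {ψ : ℝ → ℝ} {α c D : ℝ}

lemma integrable_one_sub_pow (hs : Measurable s) (hs1 : ∀ᵐ y ∂lam, s y ∈ Ioo (0 : ℝ) 1) (n : ℕ) :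
    Integrable (fun y => 1 - s y ^ n) lam := by
  refine Integrable.of_bound (C := 1) (by fun_prop) ?_
  filter_upwards [hs1] with y hy
  have h0 := pow_nonneg hy.1.le n
  have h1 := pow_le_one₀ (n := n) hy.1.le hy.2.le
  rw [Real.norm_eq_abs, abs_le]
  constructor <;> linarith

lemma mul_succ_le_of_eq_integral (hs : Measurable s) (hs1 : ∀ᵐ y ∂lam, s y ∈ Ioo (0 : ℝ) 1)
    (hc : ∫ y, (1 - s y) ∂lam = D - c)
    (hψ : ∀ k : ℕ, ψ (α * (k + 1)) = D * (k + 1) - ∫ y, (1 - s y ^ (k + 1)) ∂lam) (k : ℕ) :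
    c * (k + 1) ≤ ψ (α * (k + 1)) := by
  have h : ∫ y, (1 - s y ^ (k + 1)) ∂lam ≤ ∫ y, ((k + 1 : ℕ) : ℝ) * (1 - s y) ∂lam := by
    refine integral_mono_ae (integrable_one_sub_pow hs hs1 _) ?_ ?_
    · simpa using (integrable_one_sub_pow hs hs1 1).const_mul _
    · filter_upwards [hs1] with y hy
      have := one_add_mul_le_pow (a := s y - 1) (by linarith [hy.1]) (k + 1)
      simp only [add_sub_cancel] at this
      linarith
  rw [integral_const_mul, hc] at h
  rw [hψ]
  push_cast at h
  linarith

/-- The integro-differential equation satisfied by `Iser ψ α` when `ψ` is the exponent of a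
process with drift `D` and finite jump measure. -/
lemma mul_IserDeriv_eq (hs : Measurable s) (hs1 : ∀ᵐ y ∂lam, s y ∈ Ioo (0 : ℝ) 1)
    (hc0 : 0 < c) (h : ∀ k : ℕ, c * (k + 1) ≤ ψ (α * (k + 1)))
    (hψ : ∀ k : ℕ, ψ (α * (k + 1)) = D * (k + 1) - ∫ y, (1 - s y ^ (k + 1)) ∂lam) (x : ℝ) :
    D * (x * IserDeriv ψ α x) =
      x * Iser ψ α x + ∫ y, (Iser ψ α x - Iser ψ α (s y * x)) ∂lam := by
  set a := coeffA ψ α with ha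
  have h1 : HasSum (fun n : ℕ => D * (x * (((n : ℝ) + 1) * a (n + 1) * x ^ n)))
      (D * (x * IserDeriv ψ α x)) :=
    (((summable_IserDeriv hc0 h x).hasSum).mul_left x).mul_left D
  have h2 : HasSum (fun n : ℕ => x * (a n * x ^ n)) (x * Iser ψ α x) :=
    (summable_Iser hc0 h x).hasSum.mul_left x
  have hsumabs : Summable fun n : ℕ => |a (n + 1) * x ^ (n + 1)| :=
    (summable_nat_add_iff 1).2 (summable_Iser hc0 h x).abs
  have h3 : HasSum (fun n : ℕ => ∫ y, a (n + 1) * x ^ (n + 1) * (1 - s y ^ (n + 1)) ∂lam)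
      (∫ y, (Iser ψ α x - Iser ψ α (s y * x)) ∂lam) := by
    refine hasSum_integral_of_dominated_convergence
      (fun n _ => |a (n + 1) * x ^ (n + 1)|) (fun n => by fun_prop) (fun n => ?_)
      (ae_of_all _ fun _ => hsumabs) (integrable_const _) (ae_of_all _ fun y => ?_)
    · filter_upwards [hs1] with y hy
      have h0 := pow_nonneg hy.1.le (n + 1)
      have h1 := pow_le_one₀ (n := n + 1) hy.1.le hy.2.le
      rw [norm_mul, Real.norm_eq_abs]
      refine mul_le_of_le_one_right (abs_nonneg _) ?_
      rw [Real.norm_eq_abs, abs_le]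
      constructor <;> linarith
    · have h4 : HasSum (fun n => a n * x ^ n - a n * (s y * x) ^ n)
          (Iser ψ α x - Iser ψ α (s y * x)) :=
        (summable_Iser hc0 h x).hasSum.sub (summable_Iser hc0 h (s y * x)).hasSum
      rw [← hasSum_nat_add_iff' 1] at h4
      simp only [Finset.range_one, Finset.sum_singleton, pow_zero, sub_self, sub_zero] at h4
      convert h4 using 2 with n
      rw [mul_pow]
      ring
  refine h1.unique ?_
  convert h2.add h3 using 2 with n
  rw [integral_const_mul]
  have hne : ψ (α * (n + 1)) ≠ 0 := (lt_of_lt_of_le (by positivity) (h n)).ne'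
  have hrec : a n = a (n + 1) * ψ (α * (n + 1)) := by
    rw [ha, coeffA_succ, inv_mul_cancel_right₀ hne]
  rw [hrec, hψ n]
  ring

end FunctionalEquation

section Picard

lemma abs_exp_neg_sub_exp_neg_le {x y : ℝ} (hx : 0 ≤ x) (hy : 0 ≤ y) :
    |Real.exp (-x) - Real.exp (-y)| ≤ |x - y| := by
  wlog hxy : x ≤ y generalizing x y
  · rw [abs_sub_comm, abs_sub_comm x]
    exact this hy hx (le_of_not_ge hxy)
  have h1 : Real.exp (-y) = Real.exp (-x) * Real.exp (-(y - x)) := by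
    rw [← Real.exp_add]; ring_nf
  have h2 := Real.add_one_le_exp (-(y - x))
  have h3 : Real.exp (-x) ≤ 1 := Real.exp_le_one_iff.2 (by linarith)
  rw [abs_of_nonneg (sub_nonneg.2 (Real.exp_le_exp.2 (by linarith))), abs_of_nonpos (by linarith),
    h1]
  nlinarith [Real.exp_pos (-x)]

/-- The increment `∫_t^1 f(qv)/v dv`. -/
noncomputable def logIncr (f : ℝ → ℝ) (t q : ℝ) : ℝ := ∫ v in t..1, f (q * v) / v

/-- Measurable functions with `0 ≤ f q ≤ K q⁺`. -/
structure LinearlyBounded (K : ℝ) (f : ℝ → ℝ) : Prop where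
  measurable : Measurable f
  nonneg : ∀ q, 0 ≤ f q
  le : ∀ q, f q ≤ K * max q 0

variable {K L t : ℝ} {f g : ℝ → ℝ}

lemma abs_comp_mul_div_le (hf : ∀ q, |f q| ≤ K * max q 0) (hK : 0 ≤ K) (q v : ℝ) :
    |f (q * v) / v| ≤ K * |q| := by
  rcases eq_or_ne v 0 with rfl | hv
  · simpa using by positivity
  rw [abs_div, div_le_iff₀ (abs_pos.2 hv)]
  refine (hf _).trans ?_
  rw [mul_assoc, ← abs_mul]
  gcongr
  exact max_le (le_abs_self _) (abs_nonneg _)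

lemma LinearlyBounded.abs_le (hf : LinearlyBounded K f) (q : ℝ) : |f q| ≤ K * max q 0 := by
  rw [abs_of_nonneg (hf.nonneg q)]; exact hf.le q

lemma LinearlyBounded.intervalIntegrable (hf : LinearlyBounded K f) (hK : 0 ≤ K) (q a b : ℝ) :
    IntervalIntegrable (fun v => f (q * v) / v) volume a b := by
  have hm : Measurable fun v => f (q * v) / v :=
    (hf.measurable.comp (measurable_const_mul q)).div measurable_id
  refine (intervalIntegrable_const (c := K * |q|)).mono_fun hm.aestronglyMeasurable
    (ae_of_all _ fun v => ?_)
  refine le_trans ?_ (le_abs_self (K * |q|))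
  exact abs_comp_mul_div_le hf.abs_le hK q v

lemma LinearlyBounded.continuous_logIncr (hf : LinearlyBounded K f) (hK : 0 ≤ K) (q : ℝ) :
    Continuous fun t => logIncr f t q := by
  have := (intervalIntegral.continuous_primitive (hf.intervalIntegrable hK q) 1).neg
  refine this.congr fun t => ?_
  rw [logIncr, intervalIntegral.integral_symm, Pi.neg_apply]

lemma LinearlyBounded.logIncr_nonneg (hf : LinearlyBounded K f) (ht : t ∈ Ioo (0 : ℝ) 1) (q : ℝ) :
    0 ≤ logIncr f t q :=
  intervalIntegral.integral_nonneg ht.2.le fun _ hv =>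
    div_nonneg (hf.nonneg _) (ht.1.le.trans hv.1)

lemma abs_logIncr_sub_le {K' : ℝ} (hf : LinearlyBounded K f) (hg : LinearlyBounded K' g)
    (hK : 0 ≤ K) (hK' : 0 ≤ K')
    (hfg : ∀ q, |f q - g q| ≤ L * max q 0) (ht : t ∈ Ioo (0 : ℝ) 1) (q : ℝ) :
    |logIncr f t q - logIncr g t q| ≤ L * max q 0 * (1 - t) := by
  rw [logIncr, logIncr, ← intervalIntegral.integral_sub (hf.intervalIntegrable hK q t 1)
    (hg.intervalIntegrable hK' q t 1), ← abs_of_pos (sub_pos.2 ht.2)]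
  refine intervalIntegral.norm_integral_le_of_norm_le_const (E := ℝ) fun v hv => ?_
  rw [uIoc_of_le ht.2.le] at hv
  have hv0 : 0 < v := ht.1.trans hv.1
  rw [← sub_div, Real.norm_eq_abs, abs_div, abs_of_pos hv0, div_le_iff₀ hv0]
  refine (hfg _).trans_eq ?_
  rw [mul_assoc, max_mul_of_nonneg _ _ hv0.le, zero_mul]

lemma LinearlyBounded.logIncr_mem_bernsteinSet (hf : LinearlyBounded K f) (hK : 0 ≤ K)
    (hfB : f ∈ bernsteinSet) (ht : t ∈ Ioo (0 : ℝ) 1) : logIncr f t ∈ bernsteinSet := by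
  have h := integral_mem_bernsteinSet (volume.restrict (Ioc t 1))
    (F := fun v q => f (q * v) / v) ?_ fun q => (hf.intervalIntegrable hK q t 1).1
  · convert h using 1
    ext q
    rw [logIncr, intervalIntegral.integral_of_le ht.2.le]
  · refine (ae_restrict_mem measurableSet_Ioc).mono fun v hv => ?_
    have hv0 : 0 < v := ht.1.trans hv.1
    convert smul_mem_bernsteinSet (comp_mul_mem_bernsteinSet hfB hv0.le) (inv_pos.2 hv0).le using 1
    ext q
    simp only [Pi.smul_apply, smul_eq_mul, mul_comm q]
    ring

variable {Y : Type*} [MeasurableSpace Y] {lam : Measure Y} [IsFiniteMeasure lam] {s : Y → ℝ}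
  {c D : ℝ}

/-- The map whose fixed point is the logarithmic derivative. -/
noncomputable def picard (lam : Measure Y) (s : Y → ℝ) (D : ℝ) (f : ℝ → ℝ) (q : ℝ) : ℝ :=
  D⁻¹ * (max q 0 + ∫ y, (1 - Real.exp (-logIncr f (s y) q)) ∂lam)

lemma LinearlyBounded.integrable_one_sub_exp (hf : LinearlyBounded K f) (hK : 0 ≤ K)
    (hs : Measurable s) (hs1 : ∀ᵐ y ∂lam, s y ∈ Ioo (0 : ℝ) 1) (q : ℝ) :
    Integrable (fun y => 1 - Real.exp (-logIncr f (s y) q)) lam := by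
  have hm : Measurable fun y => logIncr f (s y) q := (hf.continuous_logIncr hK q).measurable.comp hs
  refine Integrable.of_bound (C := 1)
    (measurable_const.sub hm.neg.exp).aestronglyMeasurable ?_
  filter_upwards [hs1] with y hy
  have h0 := Real.exp_pos (-logIncr f (s y) q)
  have h1 : Real.exp (-logIncr f (s y) q) ≤ 1 :=
    Real.exp_le_one_iff.2 (neg_nonpos.2 (hf.logIncr_nonneg hy q))
  rw [Real.norm_eq_abs, _root_.abs_le]
  constructor <;> linarith

lemma LinearlyBounded.picard_mem_bernsteinSet (hf : LinearlyBounded K f) (hK : 0 ≤ K)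
    (hs : Measurable s) (hs1 : ∀ᵐ y ∂lam, s y ∈ Ioo (0 : ℝ) 1) (hD : 0 < D)
    (hfB : f ∈ bernsteinSet) : picard lam s D f ∈ bernsteinSet := by
  have h := integral_mem_bernsteinSet lam
    (F := fun y q => 1 - Real.exp (-logIncr f (s y) q))
    (hs1.mono fun y hy => one_sub_exp_neg_mem_bernsteinSet (hf.logIncr_mem_bernsteinSet hK hfB hy))
    (hf.integrable_one_sub_exp hK hs hs1)
  exact smul_mem_bernsteinSet (add_mem_bernsteinSet posPart_mem_bernsteinSet h) (inv_pos.2 hD).le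

lemma abs_picard_sub_le {K' : ℝ} (hf : LinearlyBounded K f) (hg : LinearlyBounded K' g)
    (hK : 0 ≤ K) (hK' : 0 ≤ K') (hs : Measurable s) (hs1 : ∀ᵐ y ∂lam, s y ∈ Ioo (0 : ℝ) 1)
    (hD : 0 < D) (hc : ∫ y, (1 - s y) ∂lam = D - c)
    (hfg : ∀ q, |f q - g q| ≤ L * max q 0) (q : ℝ) :
    |picard lam s D f q - picard lam s D g q| ≤ (1 - c / D) * L * max q 0 := by
  rw [picard, picard, ← mul_sub, add_sub_add_left_eq_sub, ← integral_sub
    (hf.integrable_one_sub_exp hK hs hs1 q) (hg.integrable_one_sub_exp hK' hs hs1 q), abs_mul,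
    abs_of_pos (inv_pos.2 hD)]
  have h1 : |∫ y, (1 - Real.exp (-logIncr f (s y) q) - (1 - Real.exp (-logIncr g (s y) q))) ∂lam|
      ≤ ∫ y, L * max q 0 * (1 - s y) ∂lam := by
    refine norm_integral_le_of_norm_le (f := fun y => 1 - Real.exp (-logIncr f (s y) q) -
      (1 - Real.exp (-logIncr g (s y) q))) ?_ ?_
    · simpa using (integrable_one_sub_pow hs hs1 1).const_mul (L * max q 0)
    · filter_upwards [hs1] with y hy
      rw [Real.norm_eq_abs, sub_sub_sub_cancel_left, abs_sub_comm]
      exact (abs_exp_neg_sub_exp_neg_le (hf.logIncr_nonneg hy q) (hg.logIncr_nonneg hy q)).trans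
        (abs_logIncr_sub_le hf hg hK hK' hfg hy q)
  rw [integral_const_mul, hc] at h1
  calc D⁻¹ * |_| ≤ D⁻¹ * (L * max q 0 * (D - c)) := by gcongr
    _ = (1 - c / D) * L * max q 0 := by field_simp

lemma linearlyBounded_zero (hK : 0 ≤ K) : LinearlyBounded K 0 :=
  ⟨measurable_zero, fun _ => le_rfl, fun _ => mul_nonneg hK (le_max_right _ _)⟩

lemma picard_zero (κ : Measure Y) (s : Y → ℝ) (D q : ℝ) :
    picard κ s D 0 q = D⁻¹ * max q 0 := by
  simp [picard, logIncr]

lemma LinearlyBounded.picard (hc0 : 0 < c) (hf : LinearlyBounded c⁻¹ f)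
    (hs : Measurable s) (hs1 : ∀ᵐ y ∂lam, s y ∈ Ioo (0 : ℝ) 1) (hD : 0 < D)
    (hc : ∫ y, (1 - s y) ∂lam = D - c) (hfB : f ∈ bernsteinSet) :
    LinearlyBounded c⁻¹ (picard lam s D f) := by
  have hB := hf.picard_mem_bernsteinSet (by positivity) hs hs1 hD hfB
  refine ⟨(monotone_of_mem_bernsteinSet hB).measurable, nonneg_of_mem_bernsteinSet hB, fun q => ?_⟩
  have h := abs_picard_sub_le hf (linearlyBounded_zero (inv_pos.2 hc0).le) (by positivity)
    (by positivity) hs hs1 hD hc (L := c⁻¹) (fun q => by simpa using hf.abs_le q) q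
  rw [picard_zero] at h
  have h2 := (le_abs_self _).trans h
  have h3 : (1 - c / D) * c⁻¹ * max q 0 = c⁻¹ * max q 0 - D⁻¹ * max q 0 := by field_simp
  linarith

/-- A linearly bounded fixed point of `picard` is the limit of the iterates from `0`, hence belongs
to `bernsteinSet`. -/
lemma mem_bernsteinSet_of_picard_eq (hc0 : 0 < c) (hf : LinearlyBounded c⁻¹ f)
    (hs : Measurable s) (hs1 : ∀ᵐ y ∂lam, s y ∈ Ioo (0 : ℝ) 1) (hD : 0 < D)
    (hc : ∫ y, (1 - s y) ∂lam = D - c) (hfix : picard lam s D f = f) :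
    f ∈ bernsteinSet := by
  have hK : 0 ≤ c⁻¹ := by positivity
  have hcD : c ≤ D := by
    have : 0 ≤ ∫ y, (1 - s y) ∂lam :=
      integral_nonneg_of_ae (hs1.mono fun y hy => sub_nonneg.2 hy.2.le)
    linarith
  have hiter : ∀ n : ℕ, (picard lam s D)^[n] 0 ∈ bernsteinSet ∧
      LinearlyBounded c⁻¹ ((picard lam s D)^[n] 0) ∧
      ∀ q, |(picard lam s D)^[n] 0 q - f q| ≤ (1 - c / D) ^ n * c⁻¹ * max q 0 := by
    intro n
    induction n with
    | zero =>
      refine ⟨zero_mem_bernsteinSet, linearlyBounded_zero hK, fun q => ?_⟩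
      simpa using hf.abs_le q
    | succ n ih =>
      obtain ⟨h1, h2, h3⟩ := ih
      rw [Function.iterate_succ_apply']
      refine ⟨h2.picard_mem_bernsteinSet hK hs hs1 hD h1, h2.picard hc0 hs hs1 hD hc h1,
        fun q => ?_⟩
      have := abs_picard_sub_le h2 hf hK hK hs hs1 hD hc h3 q
      rw [hfix] at this
      refine this.trans_eq ?_
      ring
  refine isClosed_bernsteinSet.mem_of_tendsto (b := atTop) (tendsto_pi_nhds.2 fun q => ?_)
    (Eventually.of_forall fun n : ℕ => (hiter n).1)
  rw [tendsto_iff_norm_sub_tendsto_zero]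
  refine squeeze_zero (fun _ => norm_nonneg _) (fun n => (hiter n).2.2 q) ?_
  have hr : Tendsto (fun n : ℕ => (1 - c / D) ^ n) atTop (𝓝 0) := by
    refine tendsto_pow_atTop_nhds_zero_of_lt_one ?_ ?_
    · rw [sub_nonneg, div_le_one hD]; exact hcD
    · have : 0 < c / D := by positivity
      linarith
  simpa using (hr.mul_const c⁻¹).mul_const (max q 0)

end Picard

section LogDerivative

variable {ψ : ℝ → ℝ} {α c D : ℝ}

/-- The function `q ↦ q I'(q) / I(q)`, extended by `0` to the negative half-line. -/
noncomputable def logDerivI (ψ : ℝ → ℝ) (α q : ℝ) : ℝ :=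
  max q 0 * IserDeriv ψ α (max q 0) / Iser ψ α (max q 0)

lemma linearlyBounded_logDerivI (hc : 0 < c) (h : ∀ k : ℕ, c * (k + 1) ≤ ψ (α * (k + 1))) :
    LinearlyBounded c⁻¹ (logDerivI ψ α) := by
  have hI : ∀ q : ℝ, 0 < Iser ψ α (max q 0) := fun q =>
    one_pos.trans_le (one_le_Iser hc h (le_max_right q 0))
  refine ⟨Continuous.measurable ?_, fun q => ?_, fun q => ?_⟩
  · have h1 := continuous_Iser hc h
    have h2 := continuous_IserDeriv hc h
    exact Continuous.div (by fun_prop) (by fun_prop) fun q => (hI q).ne'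
  · exact div_nonneg (mul_nonneg (le_max_right _ _) (IserDeriv_nonneg hc h (le_max_right q 0)))
      (hI q).le
  · rw [logDerivI, div_le_iff₀ (hI q)]
    have := mul_le_mul_of_nonneg_left (IserDeriv_le hc h (le_max_right q 0)) (le_max_right q 0)
    linarith

lemma exp_neg_logIncr_logDerivI (hc : 0 < c) (h : ∀ k : ℕ, c * (k + 1) ≤ ψ (α * (k + 1))) {t : ℝ}
    (ht : t ∈ Ioo (0 : ℝ) 1) (q : ℝ) :
    Real.exp (-logIncr (logDerivI ψ α) t q) =
      Iser ψ α (t * max q 0) / Iser ψ α (max q 0) := by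
  set x := max q 0 with hx
  have hx0 : 0 ≤ x := le_max_right _ _
  have hI : ∀ v : ℝ, 0 ≤ v → 0 < Iser ψ α (x * v) := fun v hv =>
    one_pos.trans_le (one_le_Iser hc h (mul_nonneg hx0 hv))
  have hint : logIncr (logDerivI ψ α) t q
      = Real.log (Iser ψ α (x * 1)) - Real.log (Iser ψ α (x * t)) := by
    refine intervalIntegral.integral_eq_sub_of_hasDerivAt
      (f := fun v => Real.log (Iser ψ α (x * v))) (fun v hv => ?_)
      ((linearlyBounded_logDerivI hc h).intervalIntegrable (by positivity) q t 1)
    rw [uIcc_of_le ht.2.le] at hv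
    have hv0 : 0 < v := ht.1.trans_le hv.1
    have hd : HasDerivAt (fun v => Iser ψ α (x * v)) (IserDeriv ψ α (x * v) * x) v :=
      (hasDerivAt_Iser hc h (x * v)).comp v (by simpa using (hasDerivAt_id v).const_mul x)
    refine (hd.log (hI v hv0.le).ne').congr_deriv ?_
    have hmax : max (q * v) 0 = x * v := by rw [hx, max_mul_of_nonneg _ _ hv0.le, zero_mul]
    rw [logDerivI, hmax]
    field_simp
  rw [hint, neg_sub, Real.exp_sub, Real.exp_log (hI t ht.1.le), Real.exp_log (hI 1 zero_le_one),
    mul_one, mul_comm t]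

lemma logDerivI_mem_bernsteinSet {Y : Type*} [MeasurableSpace Y] {lam : Measure Y}
    [IsFiniteMeasure lam] {s : Y → ℝ} (hc0 : 0 < c)
    (hs : Measurable s) (hs1 : ∀ᵐ y ∂lam, s y ∈ Ioo (0 : ℝ) 1)
    (hc : ∫ y, (1 - s y) ∂lam = D - c)
    (hψ : ∀ k : ℕ, ψ (α * (k + 1)) = D * (k + 1) - ∫ y, (1 - s y ^ (k + 1)) ∂lam) :
    logDerivI ψ α ∈ bernsteinSet := by
  have h := mul_succ_le_of_eq_integral hs hs1 hc hψ
  have hD : 0 < D := by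
    have : 0 ≤ ∫ y, (1 - s y) ∂lam :=
      integral_nonneg_of_ae (hs1.mono fun y hy => sub_nonneg.2 hy.2.le)
    linarith
  refine mem_bernsteinSet_of_picard_eq hc0 (linearlyBounded_logDerivI hc0 h) hs hs1 hD hc ?_
  ext q
  have hI : 0 < Iser ψ α (max q 0) := one_pos.trans_le (one_le_Iser hc0 h (le_max_right q 0))
  have h1 : ∫ y, (1 - Real.exp (-logIncr (logDerivI ψ α) (s y) q)) ∂lam =
      ∫ y, (Iser ψ α (max q 0))⁻¹ *
        (Iser ψ α (max q 0) - Iser ψ α (s y * max q 0)) ∂lam := by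
    refine integral_congr_ae (hs1.mono fun y hy => ?_)
    simp only
    rw [exp_neg_logIncr_logDerivI hc0 h hy]
    field_simp
  have h2 := mul_IserDeriv_eq hs hs1 hc0 h hψ (max q 0)
  rw [picard, h1, integral_const_mul, ← sub_eq_iff_eq_add'.2 h2, logDerivI]
  field_simp
  ring

end LogDerivative

section Limits

variable {α c : ℝ}

lemma tendsto_coeffA {φ : ℕ → ℝ → ℝ} {ψ : ℝ → ℝ} (hc : 0 < c)
    (h : ∀ k : ℕ, c * (k + 1) ≤ ψ (α * (k + 1)))
    (hlim : ∀ k : ℕ, Tendsto (fun n => φ n (α * (k + 1))) atTop (𝓝 (ψ (α * (k + 1))))) (k : ℕ) :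
    Tendsto (fun n => coeffA (φ n) α k) atTop (𝓝 (coeffA ψ α k)) :=
  (tendsto_finsetProd _ fun i _ => hlim i).inv₀
    (Finset.prod_pos fun i _ => lt_of_lt_of_le (by positivity) (h i)).ne'

lemma tendsto_logDerivI {φ : ℕ → ℝ → ℝ} {ψ : ℝ → ℝ} (hc : 0 < c)
    (hφ : ∀ᶠ n in atTop, ∀ k : ℕ, c * (k + 1) ≤ φ n (α * (k + 1)))
    (hlim : ∀ k : ℕ, Tendsto (fun n => φ n (α * (k + 1))) atTop (𝓝 (ψ (α * (k + 1))))) (q : ℝ) :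
    Tendsto (fun n => logDerivI (φ n) α q) atTop (𝓝 (logDerivI ψ α q)) := by
  have h : ∀ k : ℕ, c * (k + 1) ≤ ψ (α * (k + 1)) := fun k =>
    ge_of_tendsto (hlim k) (hφ.mono fun n hn => hn k)
  have hI : Iser ψ α (max q 0) ≠ 0 := (one_pos.trans_le (one_le_Iser hc h (le_max_right q 0))).ne'
  have ha := tendsto_coeffA hc h hlim
  set x := max q 0
  have h1 : Tendsto (fun n => Iser (φ n) α x) atTop (𝓝 (Iser ψ α x)) := by
    refine tendsto_tsum_of_dominated_convergence (summable_factorial_bound 1 c⁻¹ |x|)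
      (fun k => (ha k).mul_const _) (hφ.mono fun n hn k => ?_)
    rw [Real.norm_eq_abs, abs_mul, abs_pow]
    gcongr
    exact abs_coeffA_le hc hn k
  have h2 : Tendsto (fun n => IserDeriv (φ n) α x) atTop (𝓝 (IserDeriv ψ α x)) := by
    refine tendsto_tsum_of_dominated_convergence (summable_factorial_bound (1 * c⁻¹) c⁻¹ |x|)
      (fun k => ((ha (k + 1)).const_mul _).mul_const _) (hφ.mono fun n hn k => ?_)
    rw [Real.norm_eq_abs, abs_mul, abs_pow]
    gcongr
    exact factorial_bound_succ (abs_coeffA_le hc hn) k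
  exact (h2.const_mul x).div h1 hI

end Limits

section LevyExponent

variable {σ b α u ε : ℝ} {ν : Measure ℝ}

/-- The integrand of the Lévy–Khintchine formula. -/
noncomputable def levyKernel (u r : ℝ) : ℝ :=
  Real.exp (-u * r) - 1 + (if r ≤ 1 then u * r else 0)

lemma psi_eq (σ b : ℝ) (ν : Measure ℝ) (u : ℝ) :
    psi σ b ν u = b * u + σ / 2 * u ^ 2 + ∫ r in Ioi (0 : ℝ), levyKernel u r ∂ν := rfl

lemma measurable_levyKernel (u : ℝ) : Measurable (levyKernel u) :=
  ((measurable_const_mul (-u)).exp.sub measurable_const).add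
    (Measurable.ite measurableSet_Iic (measurable_const_mul u) measurable_const)

lemma abs_levyKernel_le (hu : 0 ≤ u) {r : ℝ} (hr : 0 < r) :
    |levyKernel u r| ≤ (1 + u ^ 2) * min 1 (r ^ 2) := by
  have hur : 0 ≤ u * r := by positivity
  have h0 : 0 < Real.exp (-u * r) := Real.exp_pos _
  have h1 : Real.exp (-u * r) ≤ 1 := Real.exp_le_one_iff.2 (by linarith)
  have h2 : -u * r + 1 ≤ Real.exp (-u * r) := Real.add_one_le_exp _
  unfold levyKernel
  split_ifs with h
  · rw [min_eq_right (by nlinarith), abs_of_nonneg (by linarith)]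
    rcases le_total (u * r) 1 with h3 | h3
    · have h4 := Real.abs_exp_sub_one_sub_id_le (x := -u * r)
        (by rw [abs_le]; constructor <;> linarith)
      have h5 := (abs_le.1 h4).2
      nlinarith [sq_nonneg r]
    · nlinarith [sq_nonneg r]
  · rw [min_eq_left (by nlinarith), add_zero, abs_of_nonpos (by linarith)]
    nlinarith [sq_nonneg u]

lemma integrableOn_min_one_sq
    (hν : ∫⁻ r in Ioi (0 : ℝ), ENNReal.ofReal (min 1 (r ^ 2)) ∂ν < ⊤) :
    IntegrableOn (fun r : ℝ => min 1 (r ^ 2)) (Ioi 0) ν :=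
  (lintegral_ofReal_ne_top_iff_integrable (by fun_prop)
    (ae_of_all _ fun r => le_min zero_le_one (sq_nonneg r))).1 hν.ne

lemma integrableOn_levyKernel
    (hν : ∫⁻ r in Ioi (0 : ℝ), ENNReal.ofReal (min 1 (r ^ 2)) ∂ν < ⊤) (hu : 0 ≤ u) :
    IntegrableOn (levyKernel u) (Ioi 0) ν := by
  refine Integrable.mono' ((integrableOn_min_one_sq hν).const_mul (1 + u ^ 2))
    (measurable_levyKernel u).aestronglyMeasurable ?_
  filter_upwards [ae_restrict_mem measurableSet_Ioi] with r hr
  exact abs_levyKernel_le hu hr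

lemma measure_Ioi_lt_top (hν : ∫⁻ r in Ioi (0 : ℝ), ENNReal.ofReal (min 1 (r ^ 2)) ∂ν < ⊤)
    (hε : 0 < ε) : ν (Ioi ε) < ⊤ := by
  have h := (integrableOn_min_one_sq hν).measure_ge_lt_top (ε := min 1 (ε ^ 2)) (by positivity)
  refine lt_of_le_of_lt ?_ h
  rw [← Measure.restrict_eq_self ν (Ioi_subset_Ioi hε.le)]
  refine measure_mono fun r (hr : ε < r) => ?_
  simp only [mem_ofPred_eq]
  gcongr

lemma setIntegral_Ioi_pos {g : ℝ → ℝ} (hν : ν (Ioi 0) ≠ 0) (hg : IntegrableOn g (Ioi 0) ν)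
    (hpos : ∀ r, 0 < r → 0 < g r) : 0 < ∫ r in Ioi (0 : ℝ), g r ∂ν := by
  rw [setIntegral_pos_iff_support_of_nonneg_ae]
  · have : Function.support g ∩ Ioi 0 = Ioi 0 :=
      inter_eq_right.2 fun r hr => (hpos r hr).ne'
    rw [this]
    exact pos_iff_ne_zero.2 hν
  · exact (ae_restrict_mem measurableSet_Ioi).mono fun r hr => (hpos r hr).le
  · exact hg

lemma psi_eq_of_measure_eq_zero (hν : ν (Ioi 0) = 0) (u : ℝ) :
    psi 0 b ν u = b * u := by
  rw [psi, Measure.restrict_eq_zero.2 hν]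
  simp

/-- The exponent is positive on `(0,∞)` when the mean is nonnegative. -/
lemma psi_pos_of_mean_nonneg (hσ : 0 ≤ σ)
    (hν : ∫⁻ r in Ioi (0 : ℝ), ENNReal.ofReal (min 1 (r ^ 2)) ∂ν < ⊤)
    (hnd : 0 < σ ∨ ν (Ioi 0) ≠ 0 ∨ b ≠ 0) (hα : 0 < α)
    (hi : IntegrableOn (fun r => r) (Ioi 1) ν) (hm : 0 ≤ b - ∫ r in Ioi (1 : ℝ), r ∂ν) :
    0 < psi σ b ν α := by
  have hind : IntegrableOn ((Ioi (1 : ℝ)).indicator fun r => α * r) (Ioi 0) ν :=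
    ((integrable_indicator_iff measurableSet_Ioi).2 (hi.const_mul α)).integrableOn
  have hker := integrableOn_levyKernel hν hα.le
  have hg : ∀ r : ℝ, levyKernel α r + (Ioi (1 : ℝ)).indicator (fun r => α * r) r =
      Real.exp (-α * r) - 1 + α * r := by
    intro r
    by_cases h : r ≤ 1
    · simp [levyKernel, h]
    · simp [levyKernel, h, not_le.1 h]
  have hpos : ∀ r : ℝ, 0 < r →
      0 < levyKernel α r + (Ioi (1 : ℝ)).indicator (fun r => α * r) r := by
    intro r hr
    rw [hg]
    have : -α * r ≠ 0 := by
      have := mul_pos hα hr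
      linarith
    linarith [Real.add_one_lt_exp this]
  have hsplit : ∫ r in Ioi (0 : ℝ), levyKernel α r ∂ν =
      ∫ r in Ioi (0 : ℝ), (levyKernel α r + (Ioi (1 : ℝ)).indicator (fun r => α * r) r) ∂ν
        - α * ∫ r in Ioi (1 : ℝ), r ∂ν := by
    rw [integral_add hker hind, setIntegral_indicator measurableSet_Ioi,
      inter_eq_right.2 (Ioi_subset_Ioi zero_le_one), integral_const_mul]
    ring
  have hnn : 0 ≤ ∫ r in Ioi (0 : ℝ),
      (levyKernel α r + (Ioi (1 : ℝ)).indicator (fun r => α * r) r) ∂ν :=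
    setIntegral_nonneg measurableSet_Ioi fun r hr => (hpos r hr).le
  have hmα := mul_nonneg hm hα.le
  have hσα : 0 ≤ σ / 2 * α ^ 2 := by positivity
  rcases hσ.eq_or_lt with rfl | hσ'
  · by_cases hν0 : ν (Ioi 0) = 0
    · have hb : b ≠ 0 := by simpa [hν0] using hnd
      have h1 : ν (Ioi 1) = 0 := measure_mono_null (Ioi_subset_Ioi zero_le_one) hν0
      rw [Measure.restrict_eq_zero.2 h1, integral_zero_measure, sub_zero] at hm
      rw [psi_eq_of_measure_eq_zero hν0]
      exact mul_pos (hm.lt_of_ne' hb) hα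
    · have := setIntegral_Ioi_pos hν0 (hker.add hind) hpos
      simp only [Pi.add_apply] at this
      rw [psi_eq, hsplit]
      linarith
  · have : 0 < σ / 2 * α ^ 2 := by positivity
    rw [psi_eq, hsplit]
    linarith

/-- The exponent is positive to the right of a positive root. -/
lemma psi_pos_of_root_lt (hσ : 0 ≤ σ)
    (hν : ∫⁻ r in Ioi (0 : ℝ), ENNReal.ofReal (min 1 (r ^ 2)) ∂ν < ⊤)
    (hnd : 0 < σ ∨ ν (Ioi 0) ≠ 0 ∨ b ≠ 0) {θ : ℝ} (hθ : 0 < θ) (hroot : psi σ b ν θ = 0)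
    (hθα : θ < α) : 0 < psi σ b ν α := by
  have hα : 0 < α := hθ.trans hθα
  have hp : 1 < α / θ := by rwa [one_lt_div hθ]
  have hker := integrableOn_levyKernel hν hα.le
  have hker' := (integrableOn_levyKernel hν hθ.le).const_mul (α / θ)
  have hpos : ∀ r : ℝ, 0 < r → 0 < levyKernel α r - α / θ * levyKernel θ r := by
    intro r hr
    have h1 : levyKernel α r - α / θ * levyKernel θ r =
        Real.exp (-α * r) - (1 + α / θ * (Real.exp (-θ * r) - 1)) := by
      unfold levyKernel
      split_ifs
      · field_simp
        ring
      · ring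
    have hx : Real.exp (-θ * r) < 1 :=
      Real.exp_lt_one_iff.2 (by nlinarith [mul_pos hθ hr])
    have h2 := one_add_mul_self_lt_rpow_one_add (s := Real.exp (-θ * r) - 1)
      (by linarith [Real.exp_pos (-θ * r)]) (by linarith) hp
    rw [add_sub_cancel, ← Real.exp_mul] at h2
    have h3 : -θ * r * (α / θ) = -α * r := by field_simp
    rw [h3] at h2
    rw [h1]
    linarith
  have hdiff : psi σ b ν α = σ / 2 * (α * (α - θ)) +
      ∫ r in Ioi (0 : ℝ), (levyKernel α r - α / θ * levyKernel θ r) ∂ν := by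
    have : psi σ b ν α = psi σ b ν α - α / θ * psi σ b ν θ := by rw [hroot]; ring
    rw [this, integral_sub hker hker', integral_const_mul, psi_eq, psi_eq]
    field_simp
    ring
  have hnn : 0 ≤ ∫ r in Ioi (0 : ℝ), (levyKernel α r - α / θ * levyKernel θ r) ∂ν :=
    setIntegral_nonneg measurableSet_Ioi fun r hr => (hpos r hr).le
  have hαθ : 0 < α * (α - θ) := mul_pos hα (sub_pos.2 hθα)
  rcases hσ.eq_or_lt with rfl | hσ'
  · by_cases hν0 : ν (Ioi 0) = 0
    · have hb : b ≠ 0 := by simpa [hν0] using hnd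
      rw [psi_eq_of_measure_eq_zero hν0] at hroot
      exact absurd hroot (mul_ne_zero hb hθ.ne')
    · have := setIntegral_Ioi_pos hν0 (hker.sub hker') hpos
      rw [hdiff]
      simpa using this
  · rw [hdiff]
    positivity

end LevyExponent

section Truncation

variable {σ b α u ε : ℝ} {ν : Measure ℝ}

/-- The exponent obtained by discarding the jumps smaller than `ε` and replacing the Gaussian part
by jumps of size `ε`. -/
noncomputable def psiTrunc (σ b : ℝ) (ν : Measure ℝ) (ε u : ℝ) : ℝ :=
  b * u + σ / ε ^ 2 * (Real.exp (-u * ε) - 1 + u * ε) + ∫ r in Ioi ε, levyKernel u r ∂ν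

/-- The jump measure of `psiTrunc`. -/
noncomputable def jumpMeasure (σ : ℝ) (ν : Measure ℝ) (ε : ℝ) : Measure ℝ :=
  ν.restrict (Ioi ε) + ENNReal.ofReal (σ / ε ^ 2) • Measure.dirac ε

lemma isFiniteMeasure_jumpMeasure
    (hν : ∫⁻ r in Ioi (0 : ℝ), ENNReal.ofReal (min 1 (r ^ 2)) ∂ν < ⊤) (hε : 0 < ε) :
    IsFiniteMeasure (jumpMeasure σ ν ε) := by
  have : IsFiniteMeasure (ν.restrict (Ioi ε)) :=
    isFiniteMeasure_restrict.2 (measure_Ioi_lt_top hν hε).ne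
  have : IsFiniteMeasure (ENNReal.ofReal (σ / ε ^ 2) • (Measure.dirac ε : Measure ℝ)) :=
    Measure.smul_finite _ ENNReal.ofReal_ne_top
  unfold jumpMeasure
  infer_instance

lemma ae_jumpMeasure_pos (hε : 0 < ε) : ∀ᵐ r ∂jumpMeasure σ ν ε, 0 < r := by
  refine ae_add_measure_iff.2 ⟨?_, Measure.ae_smul_measure ?_ _⟩
  · filter_upwards [ae_restrict_mem measurableSet_Ioi] with r hr
    exact hε.trans hr
  · rw [ae_dirac_iff measurableSet_Ioi]
    exact hε

lemma psiTrunc_eq (hσ : 0 ≤ σ)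
    (hν : ∫⁻ r in Ioi (0 : ℝ), ENNReal.ofReal (min 1 (r ^ 2)) ∂ν < ⊤) (hε : 0 < ε) (hu : 0 ≤ u) :
    psiTrunc σ b ν ε u =
      (b + σ / ε + ∫ r in Ioi ε, (if r ≤ 1 then r else 0) ∂ν) * u -
        ∫ r, (1 - Real.exp (-u * r)) ∂jumpMeasure σ ν ε := by
  have : IsFiniteMeasure (ν.restrict (Ioi ε)) :=
    isFiniteMeasure_restrict.2 (measure_Ioi_lt_top hν hε).ne
  have h1 : Integrable (fun r => 1 - Real.exp (-u * r)) (ν.restrict (Ioi ε)) := by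
    refine Integrable.of_bound (C := 1) (by fun_prop) ?_
    filter_upwards [ae_restrict_mem measurableSet_Ioi] with r hr
    have h0 : 0 ≤ u * r := mul_nonneg hu (hε.trans hr).le
    have h2 := Real.exp_pos (-u * r)
    have h3 : Real.exp (-u * r) ≤ 1 := Real.exp_le_one_iff.2 (by linarith)
    rw [Real.norm_eq_abs, abs_le]
    constructor <;> linarith
  have h2 : Integrable (fun r : ℝ => if r ≤ 1 then r else 0) (ν.restrict (Ioi ε)) := by
    refine Integrable.of_bound (C := 1)
      (Measurable.ite measurableSet_Iic measurable_id measurable_const).aestronglyMeasurable ?_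
    filter_upwards [ae_restrict_mem measurableSet_Ioi] with r hr
    have h0 : 0 < r := hε.trans hr
    split_ifs with h
    · rwa [Real.norm_eq_abs, abs_of_pos h0]
    · simp
  have h3 : Integrable (fun r => 1 - Real.exp (-u * r))
      (ENNReal.ofReal (σ / ε ^ 2) • (Measure.dirac ε : Measure ℝ)) :=
    (integrable_dirac (by simp)).smul_measure ENNReal.ofReal_ne_top
  have h4 : ∀ r, levyKernel u r = u * (if r ≤ 1 then r else 0) - (1 - Real.exp (-u * r)) := by
    intro r
    unfold levyKernel
    split_ifs <;> ring
  rw [psiTrunc, jumpMeasure, integral_add_measure h1 h3, integral_smul_measure, integral_dirac,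
    ENNReal.toReal_ofReal (by positivity)]
  simp only [h4]
  rw [integral_sub (h2.const_mul u) h1, integral_const_mul, smul_eq_mul]
  field_simp
  ring

lemma tendsto_gaussian_trunc (hσ : 0 ≤ σ) (hu : 0 ≤ u) :
    Tendsto (fun ε => σ / ε ^ 2 * (Real.exp (-u * ε) - 1 + u * ε)) (𝓝[>] 0)
      (𝓝 (σ / 2 * u ^ 2)) := by
  rw [tendsto_iff_norm_sub_tendsto_zero]
  have hlim : Tendsto (fun ε : ℝ => σ * u ^ 3 * ε) (𝓝[>] 0) (𝓝 0) := by
    have : Tendsto (fun ε : ℝ => σ * u ^ 3 * ε) (𝓝 0) (𝓝 (σ * u ^ 3 * 0)) :=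
      tendsto_id.const_mul _
    rw [mul_zero] at this
    exact this.mono_left nhdsWithin_le_nhds
  have hsmall : ∀ᶠ ε : ℝ in 𝓝[>] 0, u * ε ≤ 1 := by
    have : Tendsto (fun ε : ℝ => u * ε) (𝓝 0) (𝓝 (u * 0)) := tendsto_id.const_mul _
    rw [mul_zero] at this
    exact (this.mono_left nhdsWithin_le_nhds).eventually_le_const one_pos
  refine squeeze_zero' (Eventually.of_forall fun _ => norm_nonneg _) ?_ hlim
  filter_upwards [hsmall, self_mem_nhdsWithin] with ε h1 (hε : 0 < ε)
  have hue : 0 ≤ u * ε := by positivity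
  have h2 := Real.exp_bound (x := -u * ε) (n := 3) (by rw [abs_le]; constructor <;> linarith)
    (by norm_num)
  have h3 : |-u * ε| = u * ε := by rw [neg_mul, abs_neg, abs_of_nonneg hue]
  rw [h3] at h2
  norm_num [Finset.sum_range_succ, Nat.factorial] at h2
  have h4 : σ / ε ^ 2 * (Real.exp (-u * ε) - 1 + u * ε) - σ / 2 * u ^ 2 =
      σ / ε ^ 2 * (Real.exp (-(u * ε)) - (1 + -(u * ε) + (u * ε) ^ 2 / 2)) := by
    field_simp
    ring
  rw [h4, Real.norm_eq_abs, abs_mul, abs_of_nonneg (by positivity)]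
  calc σ / ε ^ 2 * |Real.exp (-(u * ε)) - (1 + -(u * ε) + (u * ε) ^ 2 / 2)|
      ≤ σ / ε ^ 2 * ((u * ε) ^ 3 * (2 / 9)) := by gcongr
    _ = σ * u ^ 3 * ε * (2 / 9) := by field_simp
    _ ≤ σ * u ^ 3 * ε := mul_le_of_le_one_right (by positivity) (by norm_num)

lemma tendsto_psiTrunc (hσ : 0 ≤ σ)
    (hν : ∫⁻ r in Ioi (0 : ℝ), ENNReal.ofReal (min 1 (r ^ 2)) ∂ν < ⊤) (hu : 0 ≤ u) :
    Tendsto (fun n : ℕ => psiTrunc σ b ν (1 / (n + 1)) u) atTop (𝓝 (psi σ b ν u)) := by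
  have hε : Tendsto (fun n : ℕ => 1 / ((n : ℝ) + 1)) atTop (𝓝[>] 0) :=
    tendsto_nhdsWithin_iff.2 ⟨tendsto_one_div_add_atTop_nhds_zero_nat,
      Eventually.of_forall fun n => by simp only [mem_Ioi]; positivity⟩
  have hU : ⋃ n : ℕ, Ioi (1 / ((n : ℝ) + 1)) = Ioi 0 := by
    ext r
    simp only [mem_iUnion, mem_Ioi]
    exact ⟨fun ⟨n, hn⟩ => lt_trans (by positivity) hn, exists_nat_one_div_lt⟩
  have h := tendsto_setIntegral_of_monotone (f := levyKernel u) (μ := ν)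
    (s := fun n : ℕ => Ioi (1 / ((n : ℝ) + 1))) (fun n => measurableSet_Ioi)
    (fun m n hmn => Ioi_subset_Ioi (Nat.one_div_le_one_div hmn))
    (by rw [hU]; exact integrableOn_levyKernel hν hu)
  rw [hU] at h
  exact (((tendsto_gaussian_trunc hσ hu).comp hε).const_add (b * u)).add h

/-- If `ψ(α) > 0`, then `ψ` grows at least linearly along the multiples of `α`, and the logarithmic
derivative of `I_{α,ψ}` is Bernstein. -/
lemma psi_linear_bound_and_logDerivI_mem (hσ : 0 ≤ σ)
    (hν : ∫⁻ r in Ioi (0 : ℝ), ENNReal.ofReal (min 1 (r ^ 2)) ∂ν < ⊤) (hα : 0 < α)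
    (hpos : 0 < psi σ b ν α) :
    (∀ k : ℕ, psi σ b ν α / 2 * (k + 1) ≤ psi σ b ν (α * (k + 1))) ∧
      logDerivI (psi σ b ν) α ∈ bernsteinSet := by
  have hmul : ∀ k : ℕ, 0 ≤ α * ((k : ℝ) + 1) := fun k => by positivity
  have hlim : ∀ k : ℕ, Tendsto (fun n : ℕ => psiTrunc σ b ν (1 / (n + 1)) (α * (k + 1))) atTop
      (𝓝 (psi σ b ν (α * (k + 1)))) := fun k => tendsto_psiTrunc hσ hν (hmul k)
  have key : ∀ ε : ℝ, 0 < ε → psi σ b ν α / 2 < psiTrunc σ b ν ε α →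
      (∀ k : ℕ, psi σ b ν α / 2 * (k + 1) ≤ psiTrunc σ b ν ε (α * (k + 1))) ∧
        logDerivI (psiTrunc σ b ν ε) α ∈ bernsteinSet := by
    intro ε hε hlt
    have := isFiniteMeasure_jumpMeasure (σ := σ) hν hε
    have hs : Measurable fun r : ℝ => Real.exp (-α * r) := by fun_prop
    have hs1 : ∀ᵐ r ∂jumpMeasure σ ν ε, Real.exp (-α * r) ∈ Ioo (0 : ℝ) 1 := by
      filter_upwards [ae_jumpMeasure_pos hε] with r hr
      exact ⟨Real.exp_pos _, Real.exp_lt_one_iff.2 (by nlinarith [mul_pos hα hr])⟩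
    have hψ : ∀ k : ℕ, psiTrunc σ b ν ε (α * (k + 1)) =
        (b + σ / ε + ∫ r in Ioi ε, (if r ≤ 1 then r else 0) ∂ν) * α * (k + 1) -
          ∫ r, (1 - Real.exp (-α * r) ^ (k + 1)) ∂jumpMeasure σ ν ε := by
      intro k
      rw [psiTrunc_eq hσ hν hε (hmul k), mul_assoc]
      congr 2
      ext r
      rw [← Real.exp_nat_mul]
      push_cast
      ring_nf
    have hc : ∫ r, (1 - Real.exp (-α * r)) ∂jumpMeasure σ ν ε =
        (b + σ / ε + ∫ r in Ioi ε, (if r ≤ 1 then r else 0) ∂ν) * α - psiTrunc σ b ν ε α := by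
      rw [psiTrunc_eq hσ hν hε hα.le]
      ring
    refine ⟨fun k => le_trans ?_ (mul_succ_le_of_eq_integral hs hs1 hc hψ k),
      logDerivI_mem_bernsteinSet (by linarith) hs hs1 hc hψ⟩
    gcongr
  have hev : ∀ᶠ n : ℕ in atTop, psi σ b ν α / 2 < psiTrunc σ b ν (1 / (n + 1)) α :=
    (tendsto_psiTrunc hσ hν hα.le).eventually_const_lt (by linarith)
  have hev' := hev.mono fun n hn => key (1 / (n + 1)) (by positivity) hn
  refine ⟨fun k => ge_of_tendsto (hlim k) (hev'.mono fun n hn => hn.1 k), ?_⟩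
  refine isClosed_bernsteinSet.mem_of_tendsto (b := atTop) (tendsto_pi_nhds.2 fun q => ?_)
    (hev'.mono fun n hn => hn.2)
  exact tendsto_logDerivI (half_pos hpos) (hev'.mono fun n hn => hn.1) hlim q

end Truncation

section Representation

/-- The kernel `t ↦ (1 - t ^ q) / (1 - t)`, with value `q` at `t = 1`. -/
noncomputable def bernsteinKernel (q t : ℝ) : ℝ :=
  dslope (fun t : ℝ => t ^ q) 1 t

variable {q t : ℝ}

lemma bernsteinKernel_one_right : bernsteinKernel q 1 = q := by
  rw [bernsteinKernel, dslope_same]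
  simp

lemma bernsteinKernel_of_ne (ht : t ≠ 1) : bernsteinKernel q t = (1 - t)⁻¹ * (1 - t ^ q) := by
  rw [bernsteinKernel, dslope_of_ne _ ht, slope_def_field, Real.one_rpow, ← neg_sub 1 t,
    ← neg_sub 1 (t ^ q), neg_div_neg_eq, div_eq_inv_mul]

lemma one_sub_mul_bernsteinKernel : (1 - t) * bernsteinKernel q t = 1 - t ^ q := by
  have := sub_smul_dslope (fun t : ℝ => t ^ q) 1 t
  simp only [smul_eq_mul, Real.one_rpow] at this
  unfold bernsteinKernel
  linarith

lemma bernsteinKernel_one_left (t : ℝ) : bernsteinKernel 1 t = 1 := by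
  rcases eq_or_ne t 1 with rfl | ht
  · exact bernsteinKernel_one_right
  · rw [bernsteinKernel_of_ne ht, Real.rpow_one, inv_mul_cancel₀ (sub_ne_zero.2 ht.symm)]

lemma bernsteinKernel_zero_right (hq : 0 < q) : bernsteinKernel q 0 = 1 := by
  rw [bernsteinKernel_of_ne zero_ne_one, Real.zero_rpow hq.ne']
  norm_num

lemma bernsteinKernel_nonneg (hq : 0 < q) (ht : t ∈ Icc (0 : ℝ) 1) : 0 ≤ bernsteinKernel q t := by
  rcases eq_or_ne t 1 with rfl | h
  · rw [bernsteinKernel_one_right]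
    exact hq.le
  · rw [bernsteinKernel_of_ne h]
    exact mul_nonneg (inv_nonneg.2 (sub_nonneg.2 ht.2))
      (sub_nonneg.2 (Real.rpow_le_one ht.1 ht.2 hq.le))

lemma continuous_bernsteinKernel (hq : 0 < q) : Continuous (bernsteinKernel q) := by
  rw [← continuousOn_univ]
  exact (continuousOn_dslope univ_mem).2 ⟨(Real.continuous_rpow_const hq.le).continuousOn,
    (Real.hasDerivAt_rpow_const (Or.inl one_ne_zero)).differentiableAt⟩

/-- The functions represented on `(0,∞)` by a measure on `[0,1]` of mass at most `M`. -/
def representable (M : NNReal) : Set (ℝ → ℝ) :=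
  {f | ∃ ρ : FiniteMeasure (Icc (0 : ℝ) 1), ρ.mass ≤ M ∧
    ∀ q : ℝ, 0 < q → f q = ∫ t, bernsteinKernel q t ∂(ρ : Measure (Icc (0 : ℝ) 1))}

lemma integrable_bernsteinKernel (ρ : FiniteMeasure (Icc (0 : ℝ) 1)) (hq : 0 < q) :
    Integrable (fun t : Icc (0 : ℝ) 1 => bernsteinKernel q t) (ρ : Measure (Icc (0 : ℝ) 1)) :=
  ((continuous_bernsteinKernel hq).comp continuous_subtype_val).integrable_of_hasCompactSupport
    (HasCompactSupport.of_compactSpace _)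

lemma isClosed_representable (M : NNReal) : IsClosed (representable M) := by
  let F : FiniteMeasure (Icc (0 : ℝ) 1) → Ioi (0 : ℝ) → ℝ :=
    fun ρ q => ∫ t, bernsteinKernel q t ∂(ρ : Measure (Icc (0 : ℝ) 1))
  have hF : Continuous F := continuous_pi fun q =>
    FiniteMeasure.continuous_integral_continuousMap
      (⟨fun t => bernsteinKernel q t,
        (continuous_bernsteinKernel q.2).comp continuous_subtype_val⟩ : C(Icc (0 : ℝ) 1, ℝ))
  have hcomp := ((isCompact_setOfPred_finiteMeasure_le_of_compactSpace
    (Icc (0 : ℝ) 1) M).image hF).isClosed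
  have heq : representable M =
      (fun (f : ℝ → ℝ) (q : Ioi (0 : ℝ)) => f q) ⁻¹' (F '' {μ | μ.mass ≤ M}) := by
    ext f
    constructor
    · rintro ⟨ρ, h1, h2⟩
      exact ⟨ρ, h1, funext fun q => (h2 q q.2).symm⟩
    · rintro ⟨ρ, h1, h2⟩
      exact ⟨ρ, h1, fun q hq => (congrFun h2 ⟨q, hq⟩).symm⟩
  rw [heq]
  exact hcomp.preimage (continuous_pi fun q => continuous_apply _)

lemma convex_representable (M : NNReal) : Convex ℝ (representable M) := by
  rintro f ⟨ρ, hρ, hf⟩ g ⟨τ, hτ, hg⟩ a b ha hb hab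
  lift a to NNReal using ha
  lift b to NNReal using hb
  have hab' : a + b = 1 := by exact_mod_cast hab
  refine ⟨a • ρ + b • τ, ?_, fun q hq => ?_⟩
  · have : (a • ρ + b • τ).mass = a * ρ.mass + b * τ.mass := by
      simp only [FiniteMeasure.mass, FiniteMeasure.coeFn_add, FiniteMeasure.coeFn_smul,
        Pi.add_apply, Pi.smul_apply, smul_eq_mul]
    rw [this]
    calc a * ρ.mass + b * τ.mass ≤ a * M + b * M := by gcongr
      _ = M := by rw [← add_mul, hab', one_mul]
  · rw [FiniteMeasure.toMeasure_add, FiniteMeasure.toMeasure_smul, FiniteMeasure.toMeasure_smul,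
      integral_add_measure, integral_smul_nnreal_measure, integral_smul_nnreal_measure, ← hf q hq,
      ← hg q hq]
    · rfl
    · exact (integrable_bernsteinKernel ρ hq).smul_measure_nnreal
    · exact (integrable_bernsteinKernel τ hq).smul_measure_nnreal

lemma smul_one_sub_mem_representable {g : ℝ → ℝ} (hg : g ∈ laplaceSet) (n : NNReal) :
    (fun q => n * (1 - g q)) ∈ representable n := by
  refine laplaceSet_subset (T := {g | (fun q => n * (1 - g q)) ∈ representable n}) ?_ ?_ ?_ hg
  · exact (isClosed_representable n).preimage (by fun_prop)
  · intro g hg w hw a b ha hb hab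
    have := convex_representable n hg hw ha hb hab
    rw [mem_ofPred_eq]
    convert this using 1
    ext q
    simp only [Pi.add_apply, Pi.smul_apply, smul_eq_mul]
    linear_combination -(n : ℝ) * hab
  · intro r hr
    have ht1 : Real.exp (-r) ≤ 1 := Real.exp_le_one_iff.2 (by linarith)
    have ht0 : (0 : ℝ) ≤ 1 - Real.exp (-r) := sub_nonneg.2 ht1
    let t : Icc (0 : ℝ) 1 := ⟨Real.exp (-r), (Real.exp_pos _).le, ht1⟩
    let c : NNReal := n * (1 - Real.exp (-r)).toNNReal
    have hδ : IsProbabilityMeasure (Measure.dirac t) := inferInstance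
    let δ : FiniteMeasure (Icc (0 : ℝ) 1) := ⟨Measure.dirac t, inferInstance⟩
    refine ⟨c • δ, ?_, fun q hq => ?_⟩
    · have : (c • δ).mass = c := by
        have h1 : δ.mass = 1 := by
          rw [← ENNReal.coe_inj, FiniteMeasure.ennreal_mass]
          exact hδ.measure_univ
        simp only [FiniteMeasure.mass, FiniteMeasure.coeFn_smul, Pi.smul_apply] at h1 ⊢
        rw [h1, smul_eq_mul, mul_one]
      rw [this]
      refine mul_le_of_le_one_right' ?_
      exact Real.toNNReal_le_one.2 (by linarith [Real.exp_pos (-r)])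
    · have h := one_sub_mul_bernsteinKernel (t := Real.exp (-r)) (q := q)
      rw [← Real.exp_mul, neg_mul] at h
      have hc : (c : ℝ) = n * (1 - Real.exp (-r)) := by
        rw [NNReal.coe_mul, Real.coe_toNNReal _ ht0]
      rw [FiniteMeasure.toMeasure_smul, integral_smul_nnreal_measure, FiniteMeasure.toMeasure_mk,
        integral_dirac, NNReal.smul_def, smul_eq_mul, hc, mul_assoc, h]
      simp only [max_eq_left hq.le]

lemma mem_representable_of_mem_bernsteinSet {f : ℝ → ℝ} (hf : f ∈ bernsteinSet) :
    f ∈ representable (f 1).toNNReal := by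
  refine (isClosed_representable _).mem_of_tendsto (b := atTop)
    (f := fun (n : ℕ) q => ((n : ℝ) + 1) * (1 - Real.exp (-(1 / ((n : ℝ) + 1) * f q))))
    (tendsto_pi_nhds.2 fun q => ?_) (Eventually.of_forall fun n => ?_)
  · have h1 : HasDerivAt (fun h : ℝ => 1 - Real.exp (-(h * f q))) (f q) 0 := by
      have := (((hasDerivAt_id (0 : ℝ)).mul_const (f q)).neg.exp).const_sub 1
      simpa using this
    have h2 := h1.tendsto_slope_zero_right
    have hε : Tendsto (fun n : ℕ => 1 / ((n : ℝ) + 1)) atTop (𝓝[>] 0) :=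
      tendsto_nhdsWithin_iff.2 ⟨tendsto_one_div_add_atTop_nhds_zero_nat,
        Eventually.of_forall fun n => by simp only [mem_Ioi]; positivity⟩
    refine (h2.comp hε).congr fun n => ?_
    simp
  · have hn : (0 : ℝ) ≤ 1 / ((n : ℝ) + 1) := by positivity
    obtain ⟨ρ, -, hρ⟩ := smul_one_sub_mem_representable (hf _ hn) ((n : NNReal) + 1)
    simp only [NNReal.coe_add, NNReal.coe_natCast, NNReal.coe_one] at hρ
    refine ⟨ρ, ?_, hρ⟩
    have h1 := hρ 1 one_pos
    simp only [bernsteinKernel_one_left, integral_const, smul_eq_mul, mul_one] at h1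
    have h2 : (ρ.mass : ℝ) = (ρ : Measure (Icc (0 : ℝ) 1)).real univ := rfl
    have h3 : (ρ.mass : ℝ) ≤ f 1 := by
      rw [h2, ← h1]
      have := Real.add_one_le_exp (-(1 / ((n : ℝ) + 1) * f 1))
      calc ((n : ℝ) + 1) * (1 - Real.exp (-(1 / ((n : ℝ) + 1) * f 1)))
          ≤ ((n : ℝ) + 1) * (1 / ((n : ℝ) + 1) * f 1) := by gcongr; linarith
        _ = f 1 := by field_simp
    exact NNReal.le_toNNReal_of_coe_le h3

lemma min_one_neg_log_le (ht : t ∈ Ioo (0 : ℝ) 1) : (1 - t)⁻¹ * min 1 (-Real.log t) ≤ 2 := by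
  have h1 : 0 < 1 - t := sub_pos.2 ht.2
  rw [inv_mul_le_iff₀ h1]
  rcases le_total t (1 / 2) with h | h
  · exact (min_le_left _ _).trans (by linarith)
  · refine (min_le_right _ _).trans ?_
    have h2 := Real.one_sub_inv_le_log_of_pos ht.1
    have h3 : t⁻¹ - 1 ≤ (1 - t) * 2 := by
      have h4 : t * (t⁻¹ - 1) = 1 - t := by rw [mul_sub, mul_inv_cancel₀ ht.1.ne', mul_one]
      have h5 : 0 ≤ t⁻¹ - 1 := sub_nonneg.2 ((one_le_inv₀ ht.1).2 ht.2.le)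
      nlinarith
    linarith

/-- The change of variables `t = e^{-r}` turning measures on `(0,1)` into Lévy measures. -/
lemma exists_levyMeasure (ρ : Measure ℝ) [IsFiniteMeasure ρ] :
    ∃ μ : Measure ℝ, (∫⁻ r in Ioi (0 : ℝ), ENNReal.ofReal (min 1 r) ∂μ < ⊤) ∧
      ∀ q : ℝ, 0 < q → ∫ r in Ioi (0 : ℝ), (1 - Real.exp (-q * r)) ∂μ =
        ∫ t in Ioo (0 : ℝ) 1, bernsteinKernel q t ∂ρ := by
  have hd : Measurable fun t : ℝ => ENNReal.ofReal (1 - t)⁻¹ := by fun_prop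
  have hlog : Measurable fun t : ℝ => -Real.log t := by fun_prop
  set η := (ρ.restrict (Ioo 0 1)).withDensity fun t => ENNReal.ofReal (1 - t)⁻¹ with hη
  have hmem : ∀ᵐ t ∂η, t ∈ Ioo (0 : ℝ) 1 :=
    (withDensity_absolutelyContinuous _ _).ae_le (ae_restrict_mem measurableSet_Ioo)
  have hres : (η.map fun t => -Real.log t).restrict (Ioi 0) = η.map fun t => -Real.log t := by
    refine Measure.restrict_eq_self_of_ae_mem ?_
    refine (ae_map_iff hlog.aemeasurable measurableSet_Ioi).2 ?_
    filter_upwards [hmem] with t ht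
    exact neg_pos.2 (Real.log_neg ht.1 ht.2)
  refine ⟨η.map fun t => -Real.log t, ?_, fun q hq => ?_⟩
  · rw [hres, lintegral_map (by fun_prop) hlog, hη, lintegral_withDensity_eq_lintegral_mul _ hd
      (by fun_prop)]
    refine lt_of_le_of_lt (b := ∫⁻ _ in Ioo (0 : ℝ) 1, ENNReal.ofReal 2 ∂ρ) ?_ ?_
    · refine lintegral_mono_ae ?_
      filter_upwards [ae_restrict_mem measurableSet_Ioo] with t ht
      rw [Pi.mul_apply, ← ENNReal.ofReal_mul (inv_nonneg.2 (sub_nonneg.2 ht.2.le))]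
      exact ENNReal.ofReal_le_ofReal (min_one_neg_log_le ht)
    · rw [lintegral_const]
      exact ENNReal.mul_lt_top ENNReal.ofReal_lt_top (measure_lt_top _ _)
  · rw [hres, integral_map hlog.aemeasurable (by fun_prop), hη,
      integral_withDensity_eq_integral_toReal_smul hd (ae_of_all _ fun _ => ENNReal.ofReal_lt_top)]
    refine setIntegral_congr_fun measurableSet_Ioo fun t ht => ?_
    have h1 : -q * -Real.log t = Real.log t * q := by ring
    simp only [h1, smul_eq_mul, bernsteinKernel_of_ne ht.2.ne,
      ENNReal.toReal_ofReal (inv_nonneg.2 (sub_nonneg.2 ht.2.le)), ← Real.rpow_def_of_pos ht.1]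

/-- The Lévy–Khintchine representation of the elements of `bernsteinSet` vanishing at `0+`. -/
lemma exists_levyKhintchine_of_mem_bernsteinSet {f : ℝ → ℝ} (hf : f ∈ bernsteinSet)
    (h0 : Tendsto f (𝓝[>] 0) (𝓝 0)) :
    ∃ a : ℝ, 0 ≤ a ∧ ∃ μ : Measure ℝ,
      (∫⁻ r in Ioi (0 : ℝ), ENNReal.ofReal (min 1 r) ∂μ < ⊤) ∧
      ∀ q : ℝ, 0 < q → f q = a * q + ∫ r in Ioi (0 : ℝ), (1 - Real.exp (-q * r)) ∂μ := by
  obtain ⟨ρ₀, -, hρ₀⟩ := mem_representable_of_mem_bernsteinSet hf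
  set ρ : Measure ℝ := (ρ₀ : Measure (Icc (0 : ℝ) 1)).map Subtype.val with hρdef
  have hfin : IsFiniteMeasure ρ := Measure.isFiniteMeasure_map _ _
  have hint : ∀ q : ℝ, 0 < q → Integrable (bernsteinKernel q) ρ := fun q hq =>
    (integrable_map_measure (continuous_bernsteinKernel hq).aestronglyMeasurable
      measurable_subtype_coe.aemeasurable).2 (integrable_bernsteinKernel ρ₀ hq)
  have hρ : ∀ q : ℝ, 0 < q → f q = ∫ t, bernsteinKernel q t ∂ρ := by
    intro q hq
    rw [hρ₀ q hq, hρdef, integral_map measurable_subtype_coe.aemeasurable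
      (continuous_bernsteinKernel hq).aestronglyMeasurable]
  have hmem : ∀ᵐ t ∂ρ, t ∈ Icc (0 : ℝ) 1 := by
    rw [hρdef]
    refine (ae_map_iff measurable_subtype_coe.aemeasurable measurableSet_Icc).2 ?_
    exact ae_of_all _ fun t => t.2
  have hzero : ρ.real {0} = 0 := by
    refine le_antisymm (ge_of_tendsto h0 ?_) measureReal_nonneg
    filter_upwards [self_mem_nhdsWithin] with q (hq : 0 < q)
    have h1 : ∫ t in {(0 : ℝ)}, bernsteinKernel q t ∂ρ = ρ.real {0} := by
      rw [integral_singleton, bernsteinKernel_zero_right hq, smul_eq_mul, mul_one]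
    rw [hρ q hq, ← h1]
    exact setIntegral_le_integral (hint q hq) (hmem.mono fun t ht => bernsteinKernel_nonneg hq ht)
  have hmem' : ∀ᵐ t ∂ρ, t ∈ {(1 : ℝ)} ∪ Ioo 0 1 := by
    have h1 : ∀ᵐ t ∂ρ, t ≠ 0 := by
      rw [ae_iff]
      simpa [measureReal_eq_zero_iff] using hzero
    filter_upwards [hmem, h1] with t ht ht0
    rcases ht.2.eq_or_lt with h | h
    · exact Or.inl h
    · exact Or.inr ⟨ht.1.lt_of_ne' ht0, h⟩
  obtain ⟨μ, hμ, hμq⟩ := exists_levyMeasure ρ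
  refine ⟨ρ.real {1}, measureReal_nonneg, μ, hμ, fun q hq => ?_⟩
  rw [hμq q hq, hρ q hq, ← Measure.restrict_eq_self_of_ae_mem hmem',
    setIntegral_union (by simp) measurableSet_Ioo (hint q hq).integrableOn
      (hint q hq).integrableOn, integral_singleton, bernsteinKernel_one_right, smul_eq_mul,
    Measure.restrict_eq_self_of_ae_mem hmem']

end Representation

/-- Theorem 2.4, first mapping of (2.4): `q ↦ q I'_{α,ψ}(q)/I_{α,ψ}(q)` is a Bernstein
function vanishing at `0`; equivalently `q ↦ exp(-q I'_{α,ψ}(q)/I_{α,ψ}(q))` is the Laplace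
transform of an infinitely divisible probability distribution on `[0,∞)`. -/
theorem Ifun_log_deriv_bernstein (σ b : ℝ) (ν : Measure ℝ)
    (hσ : 0 ≤ σ)
    (hν : ∫⁻ r in Ioi (0 : ℝ), ENNReal.ofReal (min 1 (r ^ 2)) ∂ν < ⊤)
    (hnd : 0 < σ ∨ ν (Ioi 0) ≠ 0 ∨ b ≠ 0)
    (hns : 0 < σ ∨ ¬ IntegrableOn (fun r => r) (Ioc 0 1) ν ∨
      0 < b - ∫ r in Ioc (0 : ℝ) 1, r ∂ν)
    (α : ℝ) (hα : 0 < α)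
    (hcase : (IntegrableOn (fun r => r) (Ioi 1) ν ∧ 0 ≤ b - ∫ r in Ioi (1 : ℝ), r ∂ν) ∨
      ((¬ IntegrableOn (fun r => r) (Ioi 1) ν ∨ b - ∫ r in Ioi (1 : ℝ), r ∂ν < 0) ∧
        ∃ θ : ℝ, 0 < θ ∧ psi σ b ν θ = 0 ∧ θ < α)) :
    ∃ a : ℝ, 0 ≤ a ∧ ∃ μ : Measure ℝ,
      (∫⁻ r in Ioi (0 : ℝ), ENNReal.ofReal (min 1 r) ∂μ < ⊤) ∧
      ∀ q : ℝ, 0 ≤ q →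
        q * deriv (Iser (psi σ b ν) α) q / Iser (psi σ b ν) α q =
          a * q + ∫ r in Ioi (0 : ℝ), (1 - Real.exp (-q * r)) ∂μ := by
  have hpos : 0 < psi σ b ν α := by
    rcases hcase with ⟨hi, hm⟩ | ⟨-, θ, hθ, hroot, hθα⟩
    · exact psi_pos_of_mean_nonneg hσ hν hnd hα hi hm
    · exact psi_pos_of_root_lt hσ hν hnd hθ hroot hθα
  obtain ⟨hlb, hB⟩ := psi_linear_bound_and_logDerivI_mem hσ hν hα hpos
  have hbd := linearlyBounded_logDerivI (half_pos hpos) hlb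
  have h0 : Tendsto (logDerivI (psi σ b ν) α) (𝓝[>] 0) (𝓝 0) := by
    have hlim : Tendsto (fun q : ℝ => (psi σ b ν α / 2)⁻¹ * max q 0) (𝓝[>] 0) (𝓝 0) := by
      have : Continuous fun q : ℝ => (psi σ b ν α / 2)⁻¹ * max q 0 := by fun_prop
      simpa using (this.tendsto 0).mono_left nhdsWithin_le_nhds
    exact squeeze_zero hbd.nonneg hbd.le hlim
  obtain ⟨a, ha, μ, hμ, hrep⟩ := exists_levyKhintchine_of_mem_bernsteinSet hB h0
  refine ⟨a, ha, μ, hμ, fun q hq => ?_⟩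
  rcases hq.eq_or_lt with rfl | hq'
  · simp
  · rw [← hrep q hq', (hasDerivAt_Iser (half_pos hpos) hlb q).deriv, logDerivI, max_eq_left hq]
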